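/- arXiv:2305.06682 — 2 statements merged into one kernel-verified Lean document; each statement's English description precedes it below -/
import Mathlib

section
/- Under the dual subgradient flow with noise level δ and C₀ = ‖y(0) − ȳ‖, the tail average x̂(t) = (2/t)∫_{t/2}^t x(s) ds satisfies ‖Ax̂(t) − f‖² ≤ 2C₀²/t² + 6C₀δ/t + 6δ² for all t > 0. -/
open Set MeasureTheory

noncomputable section

notation "⟪" x ", " y "⟫" => @inner ℝ _ _ x y

/-- `u` is a subgradient of the convex function `J` at `x`. -/
def HasSubgrad {p : ℕ} (J : EuclideanSpace ℝ (Fin p) → ℝ) (u x : EuclideanSpace ℝ (Fin p)) :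
    Prop :=
  ∀ z, J x + ⟪u, z - x⟫ ≤ J z

/-- Bregman divergence `D^u(x₁,x₂) = J(x₁) - J(x₂) - ⟨u, x₁ - x₂⟩` (for `u ∈ ∂J(x₂)`). -/
def Breg {p : ℕ} (J : EuclideanSpace ℝ (Fin p) → ℝ) (u x₁ x₂ : EuclideanSpace ℝ (Fin p)) : ℝ :=
  J x₁ - J x₂ - ⟪u, x₁ - x₂⟫
open Filter Topology in
lemma ac_le_of_deriv {φ : ℝ → ℝ} {a b : ℝ} (hab : a ≤ b)
    (hφ : AbsolutelyContinuousOnInterval φ a b)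
    (h : ∀ᵐ s, s ∈ Set.Ioc a b → deriv φ s ≤ 0) : φ b ≤ φ a := by
  have h1 := hφ.integral_deriv_eq_sub
  have h2 : (∫ s in a..b, deriv φ s) ≤ 0 := by
    rw [intervalIntegral.integral_of_le hab]
    apply integral_nonpos_of_ae
    exact (ae_restrict_iff' measurableSet_Ioc).2 h
  linarith

lemma lip_ac {φ : ℝ → ℝ} {K : NNReal} (h : LipschitzWith K φ) (a b : ℝ) :
    AbsolutelyContinuousOnInterval φ a b :=
  (h.lipschitzOnWith (s := Set.uIcc a b)).absolutelyContinuousOnInterval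

lemma conj_ineq {p d : ℕ} (A : EuclideanSpace ℝ (Fin p) →L[ℝ] EuclideanSpace ℝ (Fin d))
    (J : EuclideanSpace ℝ (Fin p) → ℝ) (q : EuclideanSpace ℝ (Fin d))
    (x₁ x₂ : EuclideanSpace ℝ (Fin p)) (y₁ y₂ : EuclideanSpace ℝ (Fin d))
    (h : HasSubgrad J (-(ContinuousLinearMap.adjoint A y₁)) x₁) :
    (-J x₂ - ⟪y₂, A x₂ - q⟫) + ⟪y₂ - y₁, A x₂ - q⟫ ≤ -J x₁ - ⟪y₁, A x₁ - q⟫ := by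
  have := h x₂
  rw [inner_neg_left, ContinuousLinearMap.adjoint_inner_left, map_sub] at this
  simp only [inner_sub_left, inner_sub_right] at *
  linarith

lemma final_ineq {c δ M : ℝ} (hc : 0 ≤ c) (hδ : 0 ≤ δ) (hM : 0 ≤ M)
    (h : M ^ 2 ≤ 2 * c ^ 2 + 2 * δ ^ 2) :
    (M + δ) ^ 2 ≤ 2 * c ^ 2 + 6 * (c * δ) + 6 * δ ^ 2 := by
  have h1 : M ≤ 3 * c + 3 / 2 * δ := by
    apply abs_le_of_sq_le_sq' _ _ |>.2 <;> nlinarith [mul_nonneg hc hδ, sq_nonneg c, sq_nonneg δ]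
  nlinarith [mul_le_mul_of_nonneg_right h1 hδ]

/-- Rate for the feasibility gap of the tail average `x̂(t) = (2/t)∫_{t/2}^t x(s) ds` along the
dual subgradient flow: `‖Ax̂(t) - f‖² ≤ 2C₀²/t² + 6C₀δ/t + 6δ²` with `C₀ = ‖y(0)-ȳ‖`. -/
theorem tail_average_feasibility_rate {p d : ℕ}
    (A : EuclideanSpace ℝ (Fin p) →L[ℝ] EuclideanSpace ℝ (Fin d))
    (J : EuclideanSpace ℝ (Fin p) → ℝ) (hJ : ConvexOn ℝ Set.univ J)
    (f fδ : EuclideanSpace ℝ (Fin d)) (δ : ℝ) (hnoise : ‖fδ - f‖ ≤ δ)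
    (xb : EuclideanSpace ℝ (Fin p)) (yb : EuclideanSpace ℝ (Fin d))
    (hsub : HasSubgrad J (-(ContinuousLinearMap.adjoint A yb)) xb) (hfeas : A xb = f)
    (x : ℝ → EuclideanSpace ℝ (Fin p)) (y : ℝ → EuclideanSpace ℝ (Fin d))
    (hLip : ∃ L : NNReal, LipschitzWith L y)
    (hx : MeasureTheory.LocallyIntegrable x MeasureTheory.volume)
    (hflow : ∀ᵐ t ∂(MeasureTheory.volume.restrict (Set.Ici (0:ℝ))),
      HasDerivAt y (A (x t) - fδ) t ∧
        HasSubgrad J (-(ContinuousLinearMap.adjoint A (y t))) (x t)) :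
    ∀ t : ℝ, 0 < t →
      ‖A ((2 / t) • ∫ s in (t / 2)..t, x s) - f‖ ^ 2 ≤
        2 * ‖y 0 - yb‖ ^ 2 / t ^ 2 + 6 * ‖y 0 - yb‖ * δ / t + 6 * δ ^ 2 := by
  obtain ⟨L, hL⟩ := hLip
  intro t ht
  have hδ : 0 ≤ δ := (norm_nonneg _).trans hnoise
  set S : Set ℝ := {s | 0 < s ∧ HasDerivAt y (A (x s) - fδ) s ∧
        HasSubgrad J (-(ContinuousLinearMap.adjoint A (y s))) (x s)} with hS
  have hSae : ∀ᵐ s, 0 < s → s ∈ S := by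
    rw [ae_restrict_iff' measurableSet_Ici] at hflow
    filter_upwards [hflow] with s hs h0
    exact ⟨h0, hs h0.le⟩
  have hcl : Set.Ici (0:ℝ) ⊆ closure S := by
    have hd : Dense {s : ℝ | 0 < s → s ∈ S} := Measure.dense_of_ae hSae
    have h1 := hd.open_subset_closure_inter (isOpen_Ioi (a := (0:ℝ)))
    have h2 : Set.Ioi (0:ℝ) ∩ {s : ℝ | 0 < s → s ∈ S} ⊆ S := fun s hs => hs.2 hs.1
    have h3 := closure_minimal (h1.trans (closure_mono h2)) isClosed_closure
    rwa [closure_Ioi] at h3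
  have hext : ∀ φ : ℝ → ℝ, Continuous φ → (∀ s ∈ S, 0 ≤ φ s) → ∀ s, 0 ≤ s → 0 ≤ φ s := by
    intro φ hφ h s hs
    exact closure_minimal (s := S) (t := {s | 0 ≤ φ s}) h
      (isClosed_le continuous_const hφ) (hcl hs)
  set v : ℝ → EuclideanSpace ℝ (Fin d) := fun s => A (x s) - fδ with hv
  have hvL : ∀ s ∈ S, ‖v s‖ ≤ L := by
    intro s hs
    have := norm_deriv_le_of_lipschitz (x₀ := s) hL
    rwa [hs.2.1.deriv] at this
  set g0 : ℝ → ℝ := fun s => -J (x s) - ⟪y s, v s⟫ with hg0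
  have hg0lip : LipschitzOnWith (L * L) g0 S := by
    apply LipschitzOnWith.of_le_add_mul
    intro a ha b hb
    have h1 := conj_ineq A J fδ (x b) (x a) (y b) (y a) hb.2.2
    have h2 : |⟪y a - y b, v a⟫| ≤ ‖y a - y b‖ * ‖v a‖ := abs_real_inner_le_norm _ _
    have h3 : ‖y a - y b‖ ≤ L * dist a b := by
      rw [← dist_eq_norm]; exact hL.dist_le_mul a b
    have h4 : ‖y a - y b‖ * ‖v a‖ ≤ (L * dist a b) * L :=
      mul_le_mul h3 (hvL a ha) (norm_nonneg _) (by positivity)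
    have h5 := neg_abs_le ⟪y a - y b, v a⟫
    have h1' : g0 a + ⟪y a - y b, v a⟫ ≤ g0 b := h1
    push_cast
    nlinarith
  obtain ⟨g, hgL, hgS⟩ := hg0lip.extend_real
  have hyc : Continuous y := hL.continuous
  have hgc : Continuous g := hgL.continuous
  set gs : ℝ := -J xb - ⟪yb, A xb - fδ⟫ with hgs
  -- subgradient inequality along the flow
  have hsubg : ∀ s ∈ S, ∀ r, 0 ≤ r → 0 ≤ g r - g s - ⟪y s - y r, v s⟫ := by
    intro s hs
    apply hext
    · fun_prop
    · intro r hr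
      rw [← hgS hs, ← hgS hr]
      have := conj_ineq A J fδ (x r) (x s) (y r) (y s) hr.2.2
      have h' : g0 s + ⟪y s - y r, v s⟫ ≤ g0 r := this
      linarith
  have hup : ∀ s ∈ S, g s - gs + ⟪y s - yb, v s⟫ ≤ 0 := by
    intro s hs
    rw [← hgS hs]
    have : g0 s + ⟪y s - yb, v s⟫ ≤ gs := conj_ineq A J fδ xb (x s) yb (y s) hsub
    linarith
  have hlow : ∀ s, 0 ≤ s → 0 ≤ g s - gs + δ * ‖y s - yb‖ := by
    apply hext
    · fun_prop
    · intro s hs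
      rw [← hgS hs]
      have h1 : gs + ⟪yb - y s, A xb - fδ⟫ ≤ g0 s := conj_ineq A J fδ (x s) xb (y s) yb hs.2.2
      have h2 : |⟪yb - y s, A xb - fδ⟫| ≤ ‖yb - y s‖ * ‖A xb - fδ‖ := abs_real_inner_le_norm _ _
      have h3 : ‖A xb - fδ‖ ≤ δ := by rw [hfeas, norm_sub_rev]; exact hnoise
      have h4 := neg_abs_le ⟪yb - y s, A xb - fδ⟫
      rw [norm_sub_rev yb] at h2
      have h5 := mul_le_mul_of_nonneg_left h3 (norm_nonneg (y s - yb))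
      linarith
  have hgd : ∀ s ∈ S, DifferentiableAt ℝ g s → HasDerivAt g (-‖v s‖ ^ 2) s := by
    intro s hs hd
    have h1 : HasDerivAt (fun r => g r - g s - ⟪y s - y r, v s⟫)
        (deriv g s + ‖v s‖ ^ 2) s := by
      have h2 : HasDerivAt (fun r => y s - y r) (-(v s)) s := by
        exact hs.2.1.const_sub (y s)
      have h3 := (hd.hasDerivAt.sub_const (g s)).sub (h2.inner ℝ (hasDerivAt_const s (v s)))
      convert! h3 using 1
      simp [inner_neg_left, real_inner_self_eq_norm_sq]
    have hmin : IsLocalMin (fun r => g r - g s - ⟪y s - y r, v s⟫) s := by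
      filter_upwards [Ioi_mem_nhds hs.1] with r hr
      have := hsubg s hs r (le_of_lt hr)
      simpa using this
    have h0 := hmin.hasDerivAt_eq_zero h1
    have : deriv g s = -‖v s‖ ^ 2 := by linarith
    rw [← this]; exact hd.hasDerivAt
  set Φ : ℝ → ℝ := fun s => s * (g s - gs) + 1 / 2 * (‖y s - yb‖ * ‖y s - yb‖) with hΦ
  have hΦac : ∀ a b, AbsolutelyContinuousOnInterval Φ a b := by
    intro a b
    have h1 : AbsolutelyContinuousOnInterval (fun s : ℝ => s) a b := lip_ac LipschitzWith.id a b
    have h2 : AbsolutelyContinuousOnInterval (fun s : ℝ => g s - gs) a b :=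
      (lip_ac hgL a b).fun_sub (lip_ac (LipschitzWith.const gs) a b)
    have h3 : LipschitzWith L (fun s : ℝ => ‖y s - yb‖) := by
      have := (LipschitzWith.dist_left yb).comp hL
      simpa [Function.comp_def, dist_eq_norm] using this
    have h4 := lip_ac h3 a b
    exact (h1.fun_mul h2).fun_add ((h4.fun_mul h4).const_mul (1/2))
  have hΦd : ∀ᵐ s, 0 < s → ∃ D, D ≤ -(s * ‖v s‖ ^ 2) ∧ HasDerivAt Φ D s ∧ HasDerivAt y (v s) s := by
    filter_upwards [hSae, hgL.ae_differentiableAt_real] with s hs hd h0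
    have hs := hs h0
    have h1 := (hgd s hs hd).sub_const gs
    have h2 := (hasDerivAt_id s).mul h1
    have h3 : HasDerivAt (fun r => ‖y r - yb‖ ^ 2) (2 * ⟪y s - yb, v s⟫) s :=
      (hs.2.1.sub_const yb).norm_sq
    refine ⟨1 * (g s - gs) + s * -‖v s‖ ^ 2 + 1 / 2 * (2 * ⟪y s - yb, v s⟫), ?_, ?_, hs.2.1⟩
    rotate_left
    · have h4 := h2.add (h3.const_mul (1/2))
      convert! h4 using 1
      funext r
      simp [hΦ, sq]
    · have := hup s hs
      linarith
  have hstep1 : Φ (t/2) ≤ Φ 0 := by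
    apply ac_le_of_deriv (by positivity) (hΦac _ _)
    filter_upwards [hΦd] with s hs hs'
    obtain ⟨D, hD, hD', -⟩ := hs hs'.1
    rw [hD'.deriv]
    have : 0 ≤ s * ‖v s‖ ^ 2 := mul_nonneg hs'.1.le (sq_nonneg _)
    linarith
  set w := y t - y (t/2) with hw
  set m := (2 / t) • w with hm
  have hinn : ∀ z : EuclideanSpace ℝ (Fin d), LipschitzWith (‖z‖₊ * L) (fun s => ⟪z, y s⟫) := by
    intro z
    have := (innerSL ℝ z).lipschitz.comp hL
    rw [show ‖innerSL ℝ z‖₊ = ‖z‖₊ from NNReal.eq (innerSL_apply_norm ℝ z)] at this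
    exact this
  have hstep2 : Φ t + t / 2 * (2 * ⟪m, y t⟫ - t * ‖m‖ ^ 2) ≤
      Φ (t/2) + t / 2 * (2 * ⟪m, y (t/2)⟫ - (t/2) * ‖m‖ ^ 2) := by
    apply ac_le_of_deriv (φ := fun s => Φ s + t / 2 * (2 * ⟪m, y s⟫ - s * ‖m‖ ^ 2))
      (by linarith)
    · refine (hΦac _ _).fun_add (AbsolutelyContinuousOnInterval.const_mul _ ?_)
      refine AbsolutelyContinuousOnInterval.fun_sub
        (AbsolutelyContinuousOnInterval.const_mul _ (lip_ac (hinn m) _ _)) ?_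
      exact AbsolutelyContinuousOnInterval.fun_mul (lip_ac LipschitzWith.id _ _)
        (lip_ac (LipschitzWith.const _) _ _)
    · filter_upwards [hΦd] with s hs hs'
      have hs0 : 0 < s := lt_trans (by positivity) hs'.1
      obtain ⟨D, hD, hD', hy⟩ := hs hs0
      have h1 : HasDerivAt (fun r => ⟪m, y r⟫) ⟪m, v s⟫ s := by
        simpa using (hasDerivAt_const s m).inner ℝ hy
      have h2 := hD'.add (((h1.const_mul 2).sub
        ((hasDerivAt_id s).mul_const (‖m‖ ^ 2))).const_mul (t / 2))
      have h3 := h2.deriv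
      refine (le_of_eq h3).trans ?_
      have h4 : 0 ≤ ‖v s - m‖ ^ 2 := sq_nonneg _
      rw [norm_sub_sq_real, real_inner_comm] at h4
      have h5 : t / 2 * ‖v s‖ ^ 2 ≤ s * ‖v s‖ ^ 2 :=
        mul_le_mul_of_nonneg_right hs'.1.le (sq_nonneg _)
      nlinarith
  have hmw : ⟪m, y t⟫ - ⟪m, y (t/2)⟫ = t / 2 * ‖m‖ ^ 2 := by
    rw [← inner_sub_right, ← hw]
    have : w = (t / 2) • m := by
      rw [hm, smul_smul]; field_simp; simp
    rw [this, inner_smul_right, real_inner_self_eq_norm_sq]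
  have hΦ0 : Φ 0 = 1 / 2 * ‖y 0 - yb‖ ^ 2 := by simp [hΦ, sq]
  have hΦt : -(t ^ 2 * δ ^ 2 / 2) ≤ Φ t := by
    have h1 := mul_le_mul_of_nonneg_left (hlow t ht.le) ht.le
    simp only [hΦ]
    nlinarith [sq_nonneg (‖y t - yb‖ - t * δ)]
  have hmain : t ^ 2 * ‖m‖ ^ 2 ≤ 2 * ‖y 0 - yb‖ ^ 2 + 2 * (t ^ 2 * δ ^ 2) := by
    have e : t / 2 * (2 * ⟪m, y t⟫ - t * ‖m‖ ^ 2) -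
       t / 2 * (2 * ⟪m, y (t/2)⟫ - (t/2) * ‖m‖ ^ 2) = t ^ 2 * ‖m‖ ^ 2 / 4 := by
      linear_combination t * hmw
    linarith
  have hint : IntervalIntegrable x volume (t/2) t :=
    (hx.integrableOn_isCompact isCompact_uIcc).intervalIntegrable
  have hvint : IntervalIntegrable v volume (t/2) t := by
    have : IntervalIntegrable (fun s => A (x s)) volume (t/2) t :=
      ⟨A.integrable_comp hint.1, A.integrable_comp hint.2⟩
    exact this.sub intervalIntegrable_const
  have hvw : ∫ s in (t/2)..t, v s = w := by
    apply ext_inner_left ℝ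
    intro z
    have h1 := (lip_ac (hinn z) (t/2) t).integral_deriv_eq_sub
    have h2 : ∫ s in (t/2)..t, ⟪z, v s⟫ = ⟪z, ∫ s in (t/2)..t, v s⟫ :=
      (innerSL ℝ z).intervalIntegral_comp_comm hvint
    rw [← h2, hw, inner_sub_right, ← h1]
    apply intervalIntegral.integral_congr_ae
    filter_upwards [hSae] with s hs hs'
    rw [Set.uIoc_of_le (by linarith)] at hs'
    have hsS := hs (lt_trans (by positivity) hs'.1)
    have h1 : HasDerivAt (fun r => ⟪z, y r⟫) ⟪z, v s⟫ s := by
      simpa using (hasDerivAt_const s z).inner ℝ hsS.2.1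
    exact h1.deriv.symm
  have hAx : A ((2 / t) • ∫ s in (t / 2)..t, x s) - f = m + (fδ - f) := by
    have h1 : ∫ s in (t/2)..t, v s = A (∫ s in (t/2)..t, x s) - (t / 2) • fδ := by
      have hA : IntervalIntegrable (fun s => A (x s)) volume (t/2) t :=
        ⟨A.integrable_comp hint.1, A.integrable_comp hint.2⟩
      rw [hv, intervalIntegral.integral_sub hA intervalIntegrable_const,
        A.intervalIntegral_comp_comm hint, intervalIntegral.integral_const]
      congr 2
      ring
    have h2 : A (∫ s in (t/2)..t, x s) = w + (t / 2) • fδ := by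
      rw [← hvw, h1]; abel
    rw [map_smul, h2, smul_add, ← hm, smul_smul]
    have : 2 / t * (t / 2) = 1 := by field_simp
    rw [this, one_smul]; abel
  rw [hAx]
  have hn : ‖m + (fδ - f)‖ ≤ ‖m‖ + δ := (norm_add_le _ _).trans (by linarith)
  have hfin := final_ineq (c := ‖y 0 - yb‖ / t) (δ := δ) (M := ‖m‖) (by positivity) hδ
    (norm_nonneg _) (by
      rw [div_pow]
      have h2 : 0 < t ^ 2 := by positivity
      have h3 : ‖m‖ ^ 2 ≤ (2 * ‖y 0 - yb‖ ^ 2 + 2 * (t ^ 2 * δ ^ 2)) / t ^ 2 := by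
        rw [le_div_iff₀ h2]; linarith
      refine h3.trans (le_of_eq ?_)
      field_simp)
  calc ‖m + (fδ - f)‖ ^ 2 ≤ (‖m‖ + δ) ^ 2 := pow_le_pow_left₀ (norm_nonneg _) hn 2
    _ ≤ _ := hfin
    _ = _ := by rw [div_pow]; ring
end
end

section
/- Under the dual subgradient flow with noise level δ and C₀ = ‖y(0) − ȳ‖, for all t > 0 it holds D^{−A*y(t)}(x̄, x(t)) ≤ C₀²/(2t) + (3C₀/2)δ + (3/2)δ²t. -/
open Set MeasureTheory

noncomputable section

/-- Rate for the reverse Bregman divergence along the dual subgradient flow: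
`D^{-A*y(t)}(x̄, x(t)) ≤ C₀²/(2t) + (3C₀/2)δ + (3/2)δ²t` with `C₀ = ‖y(0)-ȳ‖`. -/
theorem reverse_bregman_rate {p d : ℕ}
    (A : EuclideanSpace ℝ (Fin p) →L[ℝ] EuclideanSpace ℝ (Fin d))
    (J : EuclideanSpace ℝ (Fin p) → ℝ) (hJ : ConvexOn ℝ Set.univ J)
    (f fδ : EuclideanSpace ℝ (Fin d)) (δ : ℝ) (hnoise : ‖fδ - f‖ ≤ δ)
    (xb : EuclideanSpace ℝ (Fin p)) (yb : EuclideanSpace ℝ (Fin d))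
    (hsub : HasSubgrad J (-(ContinuousLinearMap.adjoint A yb)) xb) (hfeas : A xb = f)
    (x : ℝ → EuclideanSpace ℝ (Fin p)) (y : ℝ → EuclideanSpace ℝ (Fin d))
    (hLip : ∃ L : NNReal, LipschitzWith L y)
    (hx : MeasureTheory.LocallyIntegrable x MeasureTheory.volume)
    (hflow : ∀ᵐ t ∂(MeasureTheory.volume.restrict (Set.Ici (0:ℝ))),
      HasDerivAt y (A (x t) - fδ) t ∧
        HasSubgrad J (-(ContinuousLinearMap.adjoint A (y t))) (x t)) :
    ∀ t : ℝ, 0 < t →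
      Breg J (-(ContinuousLinearMap.adjoint A (y t))) xb (x t) ≤
        ‖y 0 - yb‖ ^ 2 / (2 * t) + 3 * ‖y 0 - yb‖ / 2 * δ + 3 / 2 * δ ^ 2 * t := by
  intro t ht
  obtain ⟨L, hL⟩ := hLip
  have key : ∀ w z z', HasSubgrad J (-(ContinuousLinearMap.adjoint A w)) z →
      -J z' - ⟪w, A z' - fδ⟫ ≤ -J z - ⟪w, A z - fδ⟫ := by
    intro w z z' h
    have h1 := h z'
    rw [inner_neg_left, ContinuousLinearMap.adjoint_inner_left, map_sub, inner_sub_right] at h1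
    rw [inner_sub_right, inner_sub_right]
    linarith
  have hae : ∀ᵐ s : ℝ, 0 ≤ s → HasDerivAt y (A (x s) - fδ) s ∧
        HasSubgrad J (-(ContinuousLinearMap.adjoint A (y s))) (x s) :=
    (ae_restrict_iff' measurableSet_Ici).1 hflow
  set S : Set ℝ := {s | 0 < s ∧ HasDerivAt y (A (x s) - fδ) s ∧
        HasSubgrad J (-(ContinuousLinearMap.adjoint A (y s))) (x s)} with hS
  have hdense : Set.Ioi (0:ℝ) ⊆ closure S := by
    have h1 := (MeasureTheory.Measure.dense_of_ae hae).open_subset_closure_inter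
      (isOpen_Ioi (a := (0:ℝ)))
    refine h1.trans (closure_mono ?_)
    rintro s ⟨hs, hs'⟩
    exact ⟨hs, hs' (le_of_lt hs)⟩
  have hbd : ∀ s ∈ S, ‖A (x s) - fδ‖ ≤ L := by
    intro s hs
    rw [← hs.2.1.deriv]
    exact norm_deriv_le_of_lipschitz hL
  have half : ∀ s ∈ S, ∀ r ∈ S, (-J (x s) - ⟪y s, A (x s) - fδ⟫)
      - (-J (x r) - ⟪y r, A (x r) - fδ⟫) ≤ (L * L : NNReal) * dist s r := by
    intro s hs r hr
    have h1 := key _ _ (x s) hr.2.2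
    have h2 : ⟪y r - y s, A (x s) - fδ⟫ ≤ (L * dist r s) * L := by
      refine (real_inner_le_norm _ _).trans ?_
      have := hL.dist_le_mul r s
      rw [dist_eq_norm] at this
      exact mul_le_mul this (hbd s hs) (norm_nonneg _) (by positivity)
    rw [inner_sub_left] at h2
    rw [dist_comm] at h2
    push_cast
    linarith
  have hGlip : LipschitzOnWith (L * L) (fun s => -J (x s) - ⟪y s, A (x s) - fδ⟫) S := by
    refine LipschitzOnWith.of_dist_le_mul fun s hs r hr => ?_
    rw [Real.dist_eq, abs_le]
    have h1 := half s hs r hr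
    have h2 := half r hr s hs
    rw [dist_comm] at h2
    constructor <;> linarith
  obtain ⟨G, hG, hGeq⟩ := hGlip.extend_real
  have star : ∀ r, 0 < r → ∀ z, -J z - ⟪y r, A z - fδ⟫ ≤ G r := by
    intro r hr z
    have hcl : IsClosed {r | -J z - ⟪y r, A z - fδ⟫ ≤ G r} := by
      refine isClosed_le ?_ hG.continuous
      exact continuous_const.sub (hL.continuous.inner continuous_const)
    refine hcl.closure_subset_iff.2 ?_ (hdense hr)
    intro s hs
    have := hGeq hs
    simp only at this
    simp only [Set.mem_ofPred_eq]
    rw [← this]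
    exact key _ _ z hs.2.2
  set m : ℝ := -J xb - ⟪yb, A xb - fδ⟫ with hm
  set V : ℝ → ℝ := fun s => s * G s + (1/2) * ‖y s - yb‖ ^ 2 with hV
  have hVder : ∀ᵐ s : ℝ, 0 < s → deriv V s ≤ m := by
    filter_upwards [hae, hG.ae_differentiableAt_real] with s hs hd hpos
    obtain ⟨hy, hsg⟩ := hs hpos.le
    have hsS : s ∈ S := ⟨hpos, hy, hsg⟩
    have hGs : -J (x s) - ⟪y s, A (x s) - fδ⟫ = G s := hGeq hsS
    have hmin : IsLocalMin (fun r => G r + ⟪y r, A (x s) - fδ⟫) s := by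
      filter_upwards [Ioi_mem_nhds hpos] with r hr
      have := star r hr (x s)
      linarith
    have hder : HasDerivAt (fun r => G r + ⟪y r, A (x s) - fδ⟫)
        (deriv G s + ⟪A (x s) - fδ, A (x s) - fδ⟫) s := by
      have := hd.hasDerivAt.add (hy.inner ℝ (hasDerivAt_const s (A (x s) - fδ)))
      simpa using! this
    have h0 := hmin.hasDerivAt_eq_zero hder
    have hVd : HasDerivAt V (1 * G s + s * deriv G s
        + (1/2) * (2 * ⟪y s - yb, A (x s) - fδ⟫)) s :=
      ((hasDerivAt_id s).mul hd.hasDerivAt).add ((hy.sub_const yb).norm_sq.const_mul (1/2))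
    rw [hVd.deriv]
    have h2 := key _ _ (x s) hsub
    have h3 : 0 ≤ ⟪A (x s) - fδ, A (x s) - fδ⟫ := real_inner_self_nonneg
    have h4 : s * deriv G s ≤ 0 := mul_nonpos_of_nonneg_of_nonpos hpos.le (by linarith)
    rw [inner_sub_left]
    linarith
  have hAC : AbsolutelyContinuousOnInterval V 0 t := by
    have hN : LipschitzWith L (fun s => ‖y s - yb‖) := by
      refine LipschitzWith.of_dist_le_mul fun a b => ?_
      refine (dist_norm_norm_le _ _).trans ?_
      simpa [dist_eq_norm] using hL.dist_le_mul a b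
    have a1 := (LipschitzWith.id (α := ℝ)).lipschitzOnWith
      (s := Set.uIcc 0 t) |>.absolutelyContinuousOnInterval
    have a2 := hG.lipschitzOnWith (s := Set.uIcc 0 t) |>.absolutelyContinuousOnInterval
    have a3 := hN.lipschitzOnWith (s := Set.uIcc 0 t) |>.absolutelyContinuousOnInterval
    have := (a1.mul a2).add ((a3.mul a3).const_mul (1/2))
    have hVeq : V = id * G + fun s => 1 / 2 *
        ((fun s => ‖y s - yb‖) * fun s => ‖y s - yb‖) s := by
      funext s
      simp [hV, pow_two]
    rw [hVeq]
    exact this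
  have hint : V t - V 0 ≤ t * m := by
    rw [← hAC.integral_deriv_eq_sub]
    have : ∫ s in (0:ℝ)..t, deriv V s ≤ ∫ s in (0:ℝ)..t, m := by
      rw [intervalIntegral.integral_of_le ht.le, intervalIntegral.integral_of_le ht.le]
      refine integral_mono_ae hAC.intervalIntegrable_deriv.1 (by simp) ?_
      rw [Filter.EventuallyLE, ae_restrict_iff' measurableSet_Ioc]
      filter_upwards [hVder] with s hs hs'
      exact hs hs'.1
    simpa using this
  have hst := star t ht (x t)
  have hδ : 0 ≤ δ := (norm_nonneg _).trans hnoise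
  set r := ‖y t - yb‖ with hr
  set C := ‖y 0 - yb‖ with hC
  have hC0 : 0 ≤ C := norm_nonneg _
  have hnb : ⟪y t - yb, A xb - fδ⟫ ≤ r * δ := by
    refine (real_inner_le_norm _ _).trans ?_
    rw [hfeas, norm_sub_rev f fδ]
    exact mul_le_mul_of_nonneg_left hnoise (norm_nonneg _)
  have hB : Breg J (-(ContinuousLinearMap.adjoint A (y t))) xb (x t)
      ≤ G t - m + ⟪y t - yb, A xb - fδ⟫ := by
    unfold Breg
    rw [inner_neg_left, ContinuousLinearMap.adjoint_inner_left, map_sub, hm]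
    simp only [inner_sub_left, inner_sub_right] at hst ⊢
    linarith
  have hGt : t * (G t - m) ≤ C ^ 2 / 2 - r ^ 2 / 2 := by
    simp only [hV, zero_mul] at hint
    linarith
  have hfin : Breg J (-(ContinuousLinearMap.adjoint A (y t))) xb (x t)
      ≤ C ^ 2 / (2 * t) + δ ^ 2 * t / 2 := by
    have : C ^ 2 / (2 * t) + δ ^ 2 * t / 2 = (C ^ 2 / 2 + δ ^ 2 * t ^ 2 / 2) / t := by
      field_simp
    rw [this, le_div_iff₀ ht]
    have h5 := mul_le_mul_of_nonneg_left (hB.trans (add_le_add_right hnb (G t - m))) ht.le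
    nlinarith [sq_nonneg (r - δ * t)]
  have h6 : 0 ≤ C * δ := mul_nonneg hC0 hδ
  have h7 : 0 ≤ δ ^ 2 * t := by positivity
  linarith
end
end
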